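/- Under assumption (A), there exists a constant C' depending only on the bound of b, on the Lipschitz constant K of b in its first variable, and on T, such that for all μ₀, μ₁ ∈ P₁(ℝ^d), all t ∈ [0,T], all x ∈ ℝ^d and every continuous path 𝐱 : [0,T] → ℝ^d, |𝒴^{μ₀}(t,x,𝐱) − 𝒴^{μ₁}(t,x,𝐱)| ≤ C' W₁(μ₀, μ₁), where W₁ is the Wasserstein-1 distance. -/

import Mathlib

open MeasureTheory Set
open scoped ENNReal NNReal

noncomputable section

/-- `ℝ^d` with the Euclidean norm. -/
abbrev Ed (d : ℕ) := EuclideanSpace ℝ (Fin d)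

/-- `z : [0,T] × ℝ^d → ℝ^d` is a continuous map with at most linear growth satisfying the
fixed-point equation
`z(t,x) = x − μ̄₀ + ∫₀ᵗ b(z(s,x)+x_s, x_s) ds − ∫₀ᵗ ∫ b(z(s,y)+x_s, x_s) μ₀(dy) ds`. -/
def IsFixedPt (d : ℕ) (T : ℝ) (b : Ed d → Ed d → Ed d) (μ₀ : Measure (Ed d))
    (xb : ℝ → Ed d) (z : ℝ → Ed d → Ed d) : Prop :=
  ContinuousOn (fun p : ℝ × Ed d => z p.1 p.2) (Icc 0 T ×ˢ univ) ∧
  (∃ C : ℝ, ∀ t ∈ Icc 0 T, ∀ x : Ed d, ‖z t x‖ ≤ C * (1 + ‖x‖)) ∧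
  ∀ t ∈ Icc 0 T, ∀ x : Ed d,
    z t x = x - (∫ y, y ∂μ₀)
      + (∫ s in (0:ℝ)..t, b (z s x + xb s) (xb s))
      - ∫ s in (0:ℝ)..t, ∫ y, b (z s y + xb s) (xb s) ∂μ₀

/-- Wasserstein-1 distance (with values in `ℝ≥0∞`): infimum over couplings of the
expected distance. -/
def W1 {α : Type*} [MeasurableSpace α] [EMetricSpace α] (μ ν : Measure α) : ℝ≥0∞ :=
  ⨅ (π : Measure (α × α)) (_ : π.map Prod.fst = μ ∧ π.map Prod.snd = ν),
    ∫⁻ p, edist p.1 p.2 ∂π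

open Filter Topology

/-- A function bounded on `[0,T]` whose exponentially weighted bounds improve under a
halving self-map is controlled by the fixed point of that map. -/
theorem le_of_weighted_bound_improves {ι : Type*} {f : ℝ → ι → ℝ} {T A M L : ℝ} (hL : 0 ≤ L)
    (hA : 0 ≤ A) (hM : 0 ≤ M) (hfM : ∀ t ∈ Icc 0 T, ∀ i, f t i ≤ M)
    (hf : ∀ N : ℝ, 0 ≤ N → (∀ s ∈ Icc 0 T, ∀ i, f s i ≤ N * Real.exp (L * s)) →
      ∀ t ∈ Icc 0 T, ∀ i, f t i ≤ A + N / 2 * Real.exp (L * t)) :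
    ∀ t ∈ Icc 0 T, ∀ i, f t i ≤ 2 * A * Real.exp (L * t) := by
  have one_le : ∀ t ∈ Icc 0 T, 1 ≤ Real.exp (L * t) := fun t ht =>
    Real.one_le_exp (mul_nonneg hL ht.1)
  have iter : ∀ n : ℕ, ∀ t ∈ Icc 0 T, ∀ i,
      f t i ≤ (2 * A + M * (1 / 2) ^ n) * Real.exp (L * t) := by
    intro n
    induction n with
    | zero =>
      intro t ht i
      have h1 := one_le t ht
      have h2 := hfM t ht i
      simp only [pow_zero, mul_one]
      nlinarith
    | succ n ih =>
      intro t ht i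
      have h1 := one_le t ht
      have h2 := hf _ (by positivity) ih t ht i
      refine h2.trans ?_
      rw [pow_succ]
      nlinarith
  intro t ht i
  have lim : Tendsto (fun n : ℕ => (2 * A + M * (1 / 2 : ℝ) ^ n) * Real.exp (L * t)) atTop
      (𝓝 ((2 * A + M * 0) * Real.exp (L * t))) :=
    (((tendsto_pow_atTop_nhds_zero_of_lt_one (by norm_num) (by norm_num)).const_mul M).const_add
      (2 * A)).mul_const _
  simpa using ge_of_tendsto' lim fun n => iter n t ht i

theorem norm_integral_le_of_weighted_bound {E : Type*} [NormedAddCommGroup E] [NormedSpace ℝ E]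
    {f : ℝ → E} {κ N c t : ℝ} (hκ : 0 ≤ κ) (hN : 0 ≤ N) (ht : 0 ≤ t)
    (hf : ∀ s ∈ Icc 0 t, ‖f s‖ ≤ κ * (N * Real.exp ((4 * κ + 1) * s)) + c) :
    ‖∫ s in (0:ℝ)..t, f s‖ ≤ N / 4 * Real.exp ((4 * κ + 1) * t) + c * t := by
  have hL : 4 * κ + 1 ≠ 0 := by positivity
  have hint : ∫ s in (0:ℝ)..t, (κ * (N * Real.exp ((4 * κ + 1) * s)) + c)
      = κ * (N * ((Real.exp ((4 * κ + 1) * t) - 1) / (4 * κ + 1))) + c * t := by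
    rw [intervalIntegral.integral_add (Continuous.intervalIntegrable (by fun_prop) _ _)
      (by simp), intervalIntegral.integral_const_mul, intervalIntegral.integral_const_mul,
      intervalIntegral.integral_comp_mul_left (fun s => Real.exp s) hL, integral_exp]
    simp [div_eq_inv_mul, mul_comm]
  refine (intervalIntegral.norm_integral_le_of_norm_le ht (ae_of_all _ fun s hs =>
    hf s ⟨hs.1.le, hs.2⟩) (Continuous.intervalIntegrable (by fun_prop) _ _)).trans ?_
  rw [hint]
  refine add_le_add ?_ le_rfl
  have hfrac : κ / (4 * κ + 1) ≤ 1 / 4 := by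
    rw [div_le_div_iff₀ (by positivity) (by norm_num)]; linarith
  calc κ * (N * ((Real.exp ((4 * κ + 1) * t) - 1) / (4 * κ + 1)))
      ≤ κ * (N * (Real.exp ((4 * κ + 1) * t) / (4 * κ + 1))) := by gcongr; linarith
    _ = κ / (4 * κ + 1) * (N * Real.exp ((4 * κ + 1) * t)) := by ring
    _ ≤ 1 / 4 * (N * Real.exp ((4 * κ + 1) * t)) := by gcongr
    _ = _ := by ring

section FixedPoint

variable {d : ℕ} {T B κ : ℝ} {b : Ed d → Ed d → Ed d} {μ : Measure (Ed d)}
  {xb : ℝ → Ed d} {z : ℝ → Ed d → Ed d}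

theorem IsFixedPt.continuous_slice (hz : IsFixedPt d T b μ xb z) {s : ℝ} (hs : s ∈ Icc 0 T) :
    Continuous (z s) := by
  have := hz.1.comp (s := univ) (f := fun y : Ed d => (s, y)) (by fun_prop)
    fun y _ => ⟨hs, mem_univ _⟩
  simpa [continuousOn_univ, Function.comp_def] using this

theorem IsFixedPt.measurable_drift_slice (hz : IsFixedPt d T b μ xb z)
    (hb : Measurable (Function.uncurry b)) {s : ℝ} (hs : s ∈ Icc 0 T) :
    Measurable fun y => b (z s y + xb s) (xb s) :=
  hb.comp (((hz.continuous_slice hs).measurable.add_const _).prodMk measurable_const)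

theorem IsFixedPt.aemeasurable_drift (hz : IsFixedPt d T b μ xb z)
    (hb : Measurable (Function.uncurry b)) (hx : ContinuousOn xb (Icc 0 T))
    (ν : Measure (Ed d)) [SFinite ν] :
    AEMeasurable (fun p : ℝ × Ed d => b (z p.1 p.2 + xb p.1) (xb p.1))
      ((volume.restrict (Icc 0 T)).prod ν) := by
  have hprod : (volume.restrict (Icc (0:ℝ) T)).prod ν
      = (volume.prod ν).restrict (Icc 0 T ×ˢ univ) := by
    rw [← Measure.prod_restrict, Measure.restrict_univ]
  have hmeas : MeasurableSet (Icc 0 T ×ˢ (univ : Set (Ed d))) :=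
    measurableSet_Icc.prod MeasurableSet.univ
  rw [hprod]
  have hx' : ContinuousOn (fun p : ℝ × Ed d => xb p.1) (Icc 0 T ×ˢ univ) :=
    hx.comp continuousOn_fst fun p hp => hp.1
  exact hb.comp_aemeasurable
    (((hz.1.add hx').aemeasurable hmeas).prodMk (hx'.aemeasurable hmeas))

theorem IsFixedPt.intervalIntegrable_drift (hz : IsFixedPt d T b μ xb z)
    (hb : Measurable (Function.uncurry b)) (hx : ContinuousOn xb (Icc 0 T))
    (hB : ∀ x y, ‖b x y‖ ≤ B) (x : Ed d) {t : ℝ} (ht : t ∈ Icc 0 T) :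
    IntervalIntegrable (fun s => b (z s x + xb s) (xb s)) volume 0 t := by
  have hzx : ContinuousOn (fun s => z s x) (Icc 0 T) :=
    hz.1.comp (f := fun s : ℝ => (s, x)) (by fun_prop) fun s hs => ⟨hs, mem_univ _⟩
  have hae : AEMeasurable (fun s => b (z s x + xb s) (xb s)) (volume.restrict (Icc 0 T)) :=
    hb.comp_aemeasurable (((hzx.add hx).aemeasurable measurableSet_Icc).prodMk
      (hx.aemeasurable measurableSet_Icc))
  have hint : IntegrableOn (fun s => b (z s x + xb s) (xb s)) (Icc 0 T) :=
    Integrable.of_bound hae.aestronglyMeasurable B (ae_of_all _ fun s => hB _ _)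
  rw [intervalIntegrable_iff_integrableOn_Icc_of_le ht.1]
  exact hint.mono_set (Icc_subset_Icc_right ht.2)

theorem IsFixedPt.intervalIntegrable_integral_drift [IsProbabilityMeasure μ]
    (hz : IsFixedPt d T b μ xb z) (hb : Measurable (Function.uncurry b))
    (hx : ContinuousOn xb (Icc 0 T)) (hB : ∀ x y, ‖b x y‖ ≤ B) {t : ℝ} (ht : t ∈ Icc 0 T) :
    IntervalIntegrable (fun s => ∫ y, b (z s y + xb s) (xb s) ∂μ) volume 0 t := by
  have hint : IntegrableOn (fun s => ∫ y, b (z s y + xb s) (xb s) ∂μ) (Icc 0 T) :=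
    Integrable.of_bound
      (hz.aemeasurable_drift hb hx μ).aestronglyMeasurable.integral_prod_right' B
      (ae_of_all _ fun s => by
        simpa using norm_integral_le_of_norm_le_const (μ := μ)
          (ae_of_all _ fun y => hB (z s y + xb s) (xb s)))
  rw [intervalIntegrable_iff_integrableOn_Icc_of_le ht.1]
  exact hint.mono_set (Icc_subset_Icc_right ht.2)

theorem IsFixedPt.norm_sub_self_le [IsProbabilityMeasure μ] (hz : IsFixedPt d T b μ xb z)
    (hB : ∀ x y, ‖b x y‖ ≤ B) {t : ℝ} (ht : t ∈ Icc 0 T) (x : Ed d) :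
    ‖z t x - x‖ ≤ ‖∫ y, y ∂μ‖ + 2 * (B * T) := by
  have hB0 : 0 ≤ B := (norm_nonneg _).trans (hB 0 0)
  have hBt : B * |t - 0| ≤ B * T := by
    rw [sub_zero, abs_of_nonneg ht.1]
    exact mul_le_mul_of_nonneg_left ht.2 hB0
  have h1 : ‖∫ s in (0:ℝ)..t, b (z s x + xb s) (xb s)‖ ≤ B * T :=
    (intervalIntegral.norm_integral_le_of_norm_le_const fun s _ => hB _ _).trans hBt
  have h2 : ‖∫ s in (0:ℝ)..t, ∫ y, b (z s y + xb s) (xb s) ∂μ‖ ≤ B * T :=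
    (intervalIntegral.norm_integral_le_of_norm_le_const fun s _ => by
      simpa using norm_integral_le_of_norm_le_const (μ := μ)
        (ae_of_all _ fun y => hB (z s y + xb s) (xb s))).trans hBt
  rw [hz.2.2 t ht x]
  set m := ∫ y, y ∂μ
  set I := ∫ s in (0:ℝ)..t, b (z s x + xb s) (xb s)
  set J := ∫ s in (0:ℝ)..t, ∫ y, b (z s y + xb s) (xb s) ∂μ
  calc ‖x - m + I - J - x‖ = ‖-m + I - J‖ := by congr 1; abel
    _ ≤ ‖-m‖ + ‖I‖ + ‖J‖ := (norm_sub_le _ _).trans (by gcongr; exact norm_add_le _ _)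
    _ ≤ _ := by rw [norm_neg]; linarith

theorem IsFixedPt.norm_sub_le (hz : IsFixedPt d T b μ xb z) (hT : 0 < T)
    (hb : Measurable (Function.uncurry b)) (hx : ContinuousOn xb (Icc 0 T))
    (hB : ∀ x y, ‖b x y‖ ≤ B) (hκ : 0 ≤ κ)
    (hlip : ∀ x x' y, ‖b x y - b x' y‖ ≤ κ * ‖x - x'‖) {t : ℝ} (ht : t ∈ Icc 0 T)
    (x y : Ed d) :
    ‖z t x - z t y‖ ≤ 2 * ‖x - y‖ * Real.exp ((4 * κ + 1) * t) := by
  obtain ⟨C, hC⟩ := hz.2.1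
  refine le_of_weighted_bound_improves (ι := Unit) (f := fun t _ => ‖z t x - z t y‖)
    (M := C * (1 + ‖x‖) + C * (1 + ‖y‖)) (by positivity) (norm_nonneg _) ?_ ?_ ?_ t ht ()
  · have h0 : (0 : ℝ) ∈ Icc 0 T := ⟨le_rfl, hT.le⟩
    exact add_nonneg ((norm_nonneg _).trans (hC 0 h0 x)) ((norm_nonneg _).trans (hC 0 h0 y))
  · intro t ht _
    exact (_root_.norm_sub_le _ _).trans (add_le_add (hC t ht x) (hC t ht y))
  · intro N hN hbound t ht _
    have hI : ‖∫ s in (0:ℝ)..t, (b (z s x + xb s) (xb s) - b (z s y + xb s) (xb s))‖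
        ≤ N / 4 * Real.exp ((4 * κ + 1) * t) + 0 * t := by
      refine norm_integral_le_of_weighted_bound hκ hN ht.1 fun s hs => ?_
      refine (hlip _ _ _).trans ?_
      rw [add_sub_add_right_eq_sub, add_zero]
      exact mul_le_mul_of_nonneg_left (hbound s ⟨hs.1, hs.2.trans ht.2⟩ ()) hκ
    rw [intervalIntegral.integral_sub (hz.intervalIntegrable_drift hb hx hB x ht)
      (hz.intervalIntegrable_drift hb hx hB y ht)] at hI
    have hEq : z t x - z t y = (x - y) + ((∫ s in (0:ℝ)..t, b (z s x + xb s) (xb s))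
        - ∫ s in (0:ℝ)..t, b (z s y + xb s) (xb s)) := by
      rw [hz.2.2 t ht x, hz.2.2 t ht y]; abel
    have hN' : 0 ≤ N * Real.exp ((4 * κ + 1) * t) := by positivity
    simp only [hEq]
    refine (norm_add_le _ _).trans ?_
    linarith

/-- Stability of the fixed point with respect to the cost of a coupling of the measures. -/
theorem IsFixedPt.norm_sub_le_of_coupling {π : Measure (Ed d × Ed d)} [IsProbabilityMeasure π]
    {z₀ z₁ : ℝ → Ed d → Ed d} (hT : 0 < T) (hb : Measurable (Function.uncurry b))
    (hx : ContinuousOn xb (Icc 0 T)) (hB : ∀ x y, ‖b x y‖ ≤ B) (hκ : 0 ≤ κ)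
    (hlip : ∀ x x' y, ‖b x y - b x' y‖ ≤ κ * ‖x - x'‖)
    (h₀ : Integrable (fun p => p.1) π) (h₁ : Integrable (fun p => p.2) π)
    (hz₀ : IsFixedPt d T b (π.map Prod.fst) xb z₀) (hz₁ : IsFixedPt d T b (π.map Prod.snd) xb z₁)
    {t : ℝ} (ht : t ∈ Icc 0 T) (x : Ed d) :
    ‖z₀ t x - z₁ t x‖ ≤ 2 * ((1 + κ * (2 * Real.exp ((4 * κ + 1) * T)) * T)
      * ∫ p, ‖p.1 - p.2‖ ∂π) * Real.exp ((4 * κ + 1) * t) := by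
  have : IsProbabilityMeasure (π.map Prod.fst) :=
    Measure.isProbabilityMeasure_map measurable_fst.aemeasurable
  have : IsProbabilityMeasure (π.map Prod.snd) :=
    Measure.isProbabilityMeasure_map measurable_snd.aemeasurable
  set D := ∫ p, ‖p.1 - p.2‖ ∂π with hD
  have hD0 : 0 ≤ D := integral_nonneg fun _ => norm_nonneg _
  have hcost : Integrable (fun p => ‖p.1 - p.2‖) π := (h₀.sub h₁).norm
  have hB0 : 0 ≤ B := (norm_nonneg _).trans (hB 0 0)
  have hmean : ‖(∫ y, y ∂π.map Prod.snd) - ∫ y, y ∂π.map Prod.fst‖ ≤ D := by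
    rw [integral_map measurable_fst.aemeasurable (by fun_prop),
      integral_map measurable_snd.aemeasurable (by fun_prop), norm_sub_rev, ← integral_sub h₀ h₁]
    exact norm_integral_le_integral_norm _
  refine le_of_weighted_bound_improves (f := fun t x => ‖z₀ t x - z₁ t x‖)
    (M := (‖∫ y, y ∂π.map Prod.fst‖ + 2 * (B * T)) + (‖∫ y, y ∂π.map Prod.snd‖ + 2 * (B * T)))
    (by positivity) (by positivity) (by positivity) ?_ ?_ t ht x
  · intro t ht x
    calc ‖z₀ t x - z₁ t x‖ = ‖(z₀ t x - x) - (z₁ t x - x)‖ := by congr 1; abel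
      _ ≤ _ := (_root_.norm_sub_le _ _).trans
        (add_le_add (hz₀.norm_sub_self_le hB ht x) (hz₁.norm_sub_self_le hB ht x))
  · intro N hN hbound t ht x
    have hI : ‖∫ s in (0:ℝ)..t, (b (z₀ s x + xb s) (xb s) - b (z₁ s x + xb s) (xb s))‖
        ≤ N / 4 * Real.exp ((4 * κ + 1) * t) + 0 * t := by
      refine norm_integral_le_of_weighted_bound hκ hN ht.1 fun s hs => ?_
      refine (hlip _ _ _).trans ?_
      rw [add_sub_add_right_eq_sub, add_zero]
      exact mul_le_mul_of_nonneg_left (hbound s ⟨hs.1, hs.2.trans ht.2⟩ x) hκ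
    have hJ : ‖∫ s in (0:ℝ)..t, ((∫ y, b (z₀ s y + xb s) (xb s) ∂π.map Prod.fst)
          - ∫ y, b (z₁ s y + xb s) (xb s) ∂π.map Prod.snd)‖
        ≤ N / 4 * Real.exp ((4 * κ + 1) * t)
          + κ * (2 * Real.exp ((4 * κ + 1) * T) * D) * t := by
      refine norm_integral_le_of_weighted_bound hκ hN ht.1 fun s hs => ?_
      have hs' : s ∈ Icc 0 T := ⟨hs.1, hs.2.trans ht.2⟩
      have hm₀ := hz₀.measurable_drift_slice hb hs'
      have hm₁ := hz₁.measurable_drift_slice hb hs'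
      have hi₀ : Integrable (fun p => b (z₀ s p.1 + xb s) (xb s)) π :=
        Integrable.of_bound (hm₀.comp measurable_fst).aestronglyMeasurable B
          (ae_of_all _ fun p => hB _ _)
      have hi₁ : Integrable (fun p => b (z₁ s p.2 + xb s) (xb s)) π :=
        Integrable.of_bound (hm₁.comp measurable_snd).aestronglyMeasurable B
          (ae_of_all _ fun p => hB _ _)
      rw [integral_map measurable_fst.aemeasurable hm₀.aestronglyMeasurable,
        integral_map measurable_snd.aemeasurable hm₁.aestronglyMeasurable,
        ← integral_sub hi₀ hi₁]
      refine (norm_integral_le_of_norm_le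
        (g := fun p => κ * (N * Real.exp ((4 * κ + 1) * s))
          + κ * (2 * Real.exp ((4 * κ + 1) * T)) * ‖p.1 - p.2‖)
        ((integrable_const _).add (hcost.const_mul _)) (ae_of_all _ fun p => ?_)).trans_eq ?_
      · refine (hlip _ _ _).trans ?_
        rw [add_sub_add_right_eq_sub, mul_assoc κ, ← mul_add]
        refine mul_le_mul_of_nonneg_left ?_ hκ
        rw [← sub_add_sub_cancel _ (z₁ s p.1)]
        refine (norm_add_le _ _).trans (add_le_add (hbound s hs' p.1) ?_)
        refine (hz₁.norm_sub_le hT hb hx hB hκ hlip hs' p.1 p.2).trans ?_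
        rw [mul_right_comm]
        gcongr
        exact hs'.2
      · rw [integral_add (integrable_const _) (hcost.const_mul _), integral_const,
          integral_const_mul, ← hD]
        simp [mul_assoc]
    rw [intervalIntegral.integral_sub (hz₀.intervalIntegrable_drift hb hx hB x ht)
      (hz₁.intervalIntegrable_drift hb hx hB x ht)] at hI
    rw [intervalIntegral.integral_sub (hz₀.intervalIntegrable_integral_drift hb hx hB ht)
      (hz₁.intervalIntegrable_integral_drift hb hx hB ht)] at hJ
    have hEq : z₀ t x - z₁ t x = ((∫ y, y ∂π.map Prod.snd) - ∫ y, y ∂π.map Prod.fst)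
        + ((∫ s in (0:ℝ)..t, b (z₀ s x + xb s) (xb s))
          - ∫ s in (0:ℝ)..t, b (z₁ s x + xb s) (xb s))
        - ((∫ s in (0:ℝ)..t, ∫ y, b (z₀ s y + xb s) (xb s) ∂π.map Prod.fst)
          - ∫ s in (0:ℝ)..t, ∫ y, b (z₁ s y + xb s) (xb s) ∂π.map Prod.snd) := by
      rw [hz₀.2.2 t ht x, hz₁.2.2 t ht x]; abel
    have htT : κ * (2 * Real.exp ((4 * κ + 1) * T) * D) * t
        ≤ κ * (2 * Real.exp ((4 * κ + 1) * T) * D) * T :=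
      mul_le_mul_of_nonneg_left ht.2 (by positivity)
    simp only [hEq]
    refine (_root_.norm_sub_le _ _).trans ((add_le_add_left (norm_add_le _ _) _).trans ?_)
    linarith

end FixedPoint

/-- The fixed point `𝒴^{μ₀}` is Lipschitz in the measure `μ₀`, uniformly in `(t, x, xb)`,
with a constant depending only on the bound of `b`, its Lipschitz constant in the first
variable, and `T` (Lemma 2.3, Lipschitz continuity in `μ₀`). -/
theorem fixedPoint_lipschitz_measure (d : ℕ) (T : ℝ) (hT : 0 < T)
    (B K : ℝ) :
    ∃ C' : ℝ≥0,
      ∀ b : Ed d → Ed d → Ed d,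
        Measurable (Function.uncurry b) →
        (∀ x z : Ed d, ‖b x z‖ ≤ B) →
        (∀ x x' z : Ed d, ‖b x z - b x' z‖ ≤ K * ‖x - x'‖) →
      ∀ μ₀ μ₁ : Measure (Ed d), IsProbabilityMeasure μ₀ → IsProbabilityMeasure μ₁ →
        Integrable (fun x => x) μ₀ → Integrable (fun x => x) μ₁ →
      ∀ xb : ℝ → Ed d, ContinuousOn xb (Icc 0 T) →
      ∀ z₀ z₁ : ℝ → Ed d → Ed d,
        IsFixedPt d T b μ₀ xb z₀ → IsFixedPt d T b μ₁ xb z₁ →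
      ∀ t ∈ Icc 0 T, ∀ x : Ed d,
        (‖z₀ t x - z₁ t x‖₊ : ℝ≥0∞) ≤ (C' : ℝ≥0∞) * W1 μ₀ μ₁ := by
  set κ := |K|
  have hκ : 0 ≤ κ := abs_nonneg K
  set R : ℝ := 2 * (1 + κ * (2 * Real.exp ((4 * κ + 1) * T)) * T) * Real.exp ((4 * κ + 1) * T)
  have hR : 0 < R := by positivity
  refine ⟨R.toNNReal, fun b hb hB hlip μ₀ μ₁ hμ₀ hμ₁ h₀ h₁ xb hx z₀ z₁ hz₀ hz₁ t ht x => ?_⟩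
  have hlip' : ∀ x x' y, ‖b x y - b x' y‖ ≤ κ * ‖x - x'‖ := fun x x' y =>
    (hlip x x' y).trans (mul_le_mul_of_nonneg_right (le_abs_self K) (norm_nonneg _))
  have hR0 : (R.toNNReal : ℝ≥0∞) ≠ 0 := by simpa using hR
  rw [W1, ENNReal.mul_iInf_of_ne hR0 ENNReal.coe_ne_top]
  refine le_iInf fun π => ?_
  rw [ENNReal.mul_iInf_of_ne hR0 ENNReal.coe_ne_top]
  refine le_iInf fun hπ => ?_
  obtain ⟨rfl, rfl⟩ := hπ
  have : IsProbabilityMeasure π := Measure.isProbabilityMeasure_of_map Prod.fst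
  have h₀' : Integrable (fun p => p.1) π := h₀.comp_measurable measurable_fst
  have h₁' : Integrable (fun p => p.2) π := h₁.comp_measurable measurable_snd
  have hcost : ∫⁻ p, edist p.1 p.2 ∂π = ENNReal.ofReal (∫ p, ‖p.1 - p.2‖ ∂π) := by
    simp only [edist_eq_enorm_sub]
    exact (ofReal_integral_norm_eq_lintegral_enorm (h₀'.sub h₁')).symm
  rw [hcost, ← ENNReal.ofReal, ← ENNReal.ofReal_mul hR.le, ← enorm_eq_nnnorm, ← ofReal_norm]
  refine ENNReal.ofReal_le_ofReal ?_
  refine (IsFixedPt.norm_sub_le_of_coupling hT hb hx hB hκ hlip' h₀' h₁' hz₀ hz₁ ht x).trans ?_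
  calc _ ≤ 2 * ((1 + κ * (2 * Real.exp ((4 * κ + 1) * T)) * T) * ∫ p, ‖p.1 - p.2‖ ∂π)
        * Real.exp ((4 * κ + 1) * T) := by
        gcongr
        exact ht.2
    _ = _ := by ring

end
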